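/- Let s : X → L.Term Y be a substitution, I ⊆ X a set of variables, and t : X → Y a map such that s x = Term.var (t x) for every x ∈ I, t is injective on I, and, writing J = t '' I, no variable of J occurs in the term s x' for any x' ∉ I. Then for every subset A ⊆ (X → H), s_*(∃(I) A) = ∃(J) (s_* A). (This is the generalized quantifier–substitution identity established in the proof of Proposition 2.9.) -/

import Mathlib

open FirstOrder FirstOrder.Language

/-- The value of a term depends only on the values of the variables occurring in it. -/
theorem FirstOrder.Language.Term.realize_congr_of_eqOn_varFinset {L : Language} {H Y : Type*}
    [L.Structure H] [DecidableEq Y] {t : L.Term Y} {μ ν : Y → H}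
    (h : Set.EqOn μ ν t.varFinset) : t.realize μ = t.realize ν := by
  induction t with
  | var y => exact h (by simp [Term.varFinset])
  | func f ts ih =>
    simp only [Term.realize_func]
    congr 1
    funext i
    exact ih i fun y hy => h (by simpa [Term.varFinset] using ⟨i, hy⟩)

/-- The generalized quantifier–substitution identity from the proof of Proposition 2.9:
if `s x = var (t x)` for `x ∈ I`, `t` is injective on `I`, and no variable of `J = t '' I`
occurs in `s x'` for `x' ∉ I`, then `s⋆(∃(I) A) = ∃(J) (s⋆ A)`. -/
theorem subst_exists_set_comm {L : Language} {H X Y : Type*} [L.Structure H] [DecidableEq Y]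
    (s : X → L.Term Y) (I : Set X) (t : X → Y)
    (hvar : ∀ x ∈ I, s x = Term.var (t x))
    (hinj : Set.InjOn t I)
    (hocc : ∀ x' ∉ I, ∀ y ∈ t '' I, y ∉ (s x').varFinset)
    (A : Set (X → H)) :
    (fun ν : Y → H => fun x' : X => (s x').realize ν) ⁻¹'
        {μ : X → H | ∃ ν ∈ A, ∀ x ∉ I, μ x = ν x} =
    {μ : Y → H | ∃ ν ∈ ((fun ν : Y → H => fun x' : X => (s x').realize ν) ⁻¹' A),
        ∀ y ∉ t '' I, μ y = ν y} := by
  classical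
  have realize_eq {μ ν : Y → H} (h : ∀ y ∉ t '' I, μ y = ν y) {x : X} (hx : x ∉ I) :
      (s x).realize μ = (s x).realize ν :=
    Term.realize_congr_of_eqOn_varFinset fun y hy => h y fun hyI => hocc x hx y hyI hy
  ext μ
  constructor
  · rintro ⟨ν, hνA, hν⟩
    let μ' : Y → H := fun y => if h : y ∈ t '' I then ν h.choose else μ y
    have hμ' : ∀ y ∉ t '' I, μ y = μ' y := fun y hy => by simp only [μ', dif_neg hy]
    refine ⟨μ', ?_, hμ'⟩
    suffices h : (fun x => (s x).realize μ') = ν by simpa only [Set.mem_preimage, h] using hνA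
    funext x
    by_cases hx : x ∈ I
    · have h : t x ∈ t '' I := ⟨x, hx, rfl⟩
      rw [hvar x hx, Term.realize_var]
      exact (dif_pos h).trans (congrArg ν (hinj h.choose_spec.1 hx h.choose_spec.2))
    · exact (realize_eq hμ' hx).symm.trans (hν x hx)
  · rintro ⟨ν, hνA, hν⟩
    exact ⟨_, hνA, fun x hx => realize_eq hν hx⟩
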